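/- There exists a constant C > 0 such that for every smooth compactly supported radially symmetric function u : ℝ⁴ → ℝ (i.e., u(x) depends only on |x|) satisfying ‖Δu‖₂² + ‖∇u‖₂² ≤ 1, one has ∫_{ℝ⁴} (e^{32π²u²} − 1 − 32π²u²) dx ≤ C. -/

import Mathlib

open MeasureTheory Real

noncomputable def laplacian {N : ℕ} (u : EuclideanSpace ℝ (Fin N) → ℝ)
    (x : EuclideanSpace ℝ (Fin N)) : ℝ :=
  ∑ i : Fin N, fderiv ℝ (fderiv ℝ u) x (EuclideanSpace.single i 1) (EuclideanSpace.single i 1)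

lemma polar4 (f : ℝ → ENNReal) (hf : Measurable f) :
    ∫⁻ x : EuclideanSpace ℝ (Fin 4), f ‖x‖ =
      ENNReal.ofReal (2 * π ^ 2) * ∫⁻ y in Set.Ioi (0:ℝ), ENNReal.ofReal (y ^ 3) * f y := by
  set μ : Measure (EuclideanSpace ℝ (Fin 4)) := volume
  have hdim : Module.finrank ℝ (EuclideanSpace ℝ (Fin 4)) = 4 := by simp
  have hsph : μ.toSphere Set.univ = ENNReal.ofReal (2 * π ^ 2) := by
    rw [Measure.toSphere_apply_univ, InnerProductSpace.volume_ball_of_dim_even (k := 2) (by simp),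
      hdim]
    have : (4:ENNReal) = ENNReal.ofReal 4 := by simp
    push_cast
    rw [this, ENNReal.ofReal_one, one_pow, one_mul, ← ENNReal.ofReal_mul (by norm_num)]
    congr 1
    norm_num [Nat.factorial]
    ring
  calc
    ∫⁻ x, f (‖x‖) ∂μ = ∫⁻ x : ({(0)}ᶜ : Set (EuclideanSpace ℝ (Fin 4))), f (‖x.1‖) ∂(μ.comap (↑)) := by
      rw [lintegral_subtype_comap (measurableSet_singleton _).compl (fun x ↦ f (‖x‖)),
        restrict_compl_singleton]
    _ = ∫⁻ x, f x.2 ∂μ.toSphere.prod (.volumeIoiPow 3) := by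
      have := μ.measurePreserving_homeomorphUnitSphereProd.lintegral_comp_emb
        (Homeomorph.measurableEmbedding _) (f ∘ Subtype.val ∘ Prod.snd)
      rw [hdim] at this
      simpa using this
    _ = μ.toSphere Set.univ * ∫⁻ x : Set.Ioi (0 : ℝ), f x ∂.volumeIoiPow 3 := by
      rw [lintegral_prod _ (by fun_prop)]
      simp [mul_comm]
    _ = _ := by
      rw [hsph]
      congr 1
      simp only [Measure.volumeIoiPow]
      rw [lintegral_withDensity_eq_lintegral_mul _ (by fun_prop) (by fun_prop),
        ← lintegral_subtype_comap measurableSet_Ioi]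
      rfl

lemma cs_interval {a b : ℝ} (hab : a ≤ b) {f g : ℝ → ℝ} (hf : ContinuousOn f (Set.Icc a b))
    (hg : ContinuousOn g (Set.Icc a b)) :
    (∫ x in a..b, f x * g x) ^ 2 ≤ (∫ x in a..b, f x ^ 2) * ∫ x in a..b, g x ^ 2 := by
  rw [← Set.uIcc_of_le hab] at hf hg
  have h : ∀ c : ℝ, 0 ≤ (∫ x in a..b, g x ^ 2) * (c * c) + (2 * ∫ x in a..b, f x * g x) * c
      + ∫ x in a..b, f x ^ 2 := by
    intro c
    have h1 : (∫ x in a..b, g x ^ 2) * (c * c) + (2 * ∫ x in a..b, f x * g x) * c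
      + ∫ x in a..b, f x ^ 2 = ∫ x in a..b, (f x + c * g x) ^ 2 := by
      have e : ∀ x, (f x + c * g x) ^ 2 = (c * c) * g x ^ 2 + (2 * c) * (f x * g x) + f x ^ 2 := by
        intro x; ring
      simp_rw [e]
      rw [intervalIntegral.integral_add, intervalIntegral.integral_add,
        intervalIntegral.integral_const_mul, intervalIntegral.integral_const_mul]
      · ring
      all_goals exact ContinuousOn.intervalIntegrable (by fun_prop)
    rw [h1]
    exact intervalIntegral.integral_nonneg hab (fun x _ => sq_nonneg _)
  have := discrim_le_zero h
  unfold discrim at this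
  nlinarith

/-- One-dimensional level set estimate. -/
lemma level_set (H E : ℝ → ℝ) (hE1 : ∀ t, 0 ≤ t → E t ≤ 1)
    (hH : ∀ t, 0 ≤ t → H t ^ 2 ≤ E t * (t + 8))
    (hd : ∀ s t, 0 ≤ s → s ≤ t → (H t - H s) ^ 2 ≤ (t - s) * (E t - E s))
    (l : ℝ) (hl : 0 < l) :
    volume {t : ℝ | 0 ≤ t ∧ t + 8 - H t ^ 2 ≤ l} ≤ ENNReal.ofReal (22 * l) := by
  set S := {t : ℝ | 0 ≤ t ∧ t + 8 - H t ^ 2 ≤ l} with hS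
  have key : ∀ s t, s ∈ S → t ∈ S → 2 * l ≤ s → s ≤ t → t - s ≤ 20 * l := by
    rintro s t ⟨hs0, hs⟩ ⟨ht0, ht⟩ hls hst
    have h1 := hH s hs0
    have h2 := hd s t hs0 hst
    have h3 := hE1 t ht0
    have h5 := hE1 s hs0
    set d := t - s with hd'
    have hdn : 0 ≤ d := by linarith
    -- E s ≥ 1 - l/(s+8)
    have h4 : (E t - E s) * (s + 8) ≤ l := by nlinarith
    have hs2 : H s ^ 2 ≤ s + 8 := by nlinarith
    have hmul : (H t - H s) ^ 2 * (s + 8) ≤ d * l := by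
      calc (H t - H s) ^ 2 * (s + 8) ≤ (d * (E t - E s)) * (s + 8) := by gcongr
        _ = d * ((E t - E s) * (s + 8)) := by ring
        _ ≤ d * l := by gcongr
    have hsq : (H t - H s) ^ 2 ≤ d / 2 := by
      have : (H t - H s) ^ 2 * (2 * l) ≤ d * l := by
        refine le_trans ?_ hmul
        gcongr
        linarith
      nlinarith
    -- cross term
    have hcross : 2 * (H s * (H t - H s)) ≤ d / 4 + 4 * l := by
      have hp : (H s * (H t - H s)) ^ 2 ≤ d * l := by
        calc (H s * (H t - H s)) ^ 2 = H s ^ 2 * (H t - H s) ^ 2 := by ring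
          _ ≤ (s + 8) * (H t - H s) ^ 2 := by gcongr
          _ ≤ d * l := by linarith
      apply le_of_sq_le_sq _ (by positivity)
      nlinarith [sq_nonneg (d / 4 - 4 * l)]
    nlinarith
  by_cases hne : (S ∩ Set.Ici (2 * l)).Nonempty
  · have hbdd : BddBelow (S ∩ Set.Ici (2 * l)) := ⟨2 * l, fun x hx => hx.2⟩
    set a := sInf (S ∩ Set.Ici (2 * l)) with ha
    have hsub : S ⊆ Set.Icc 0 (2 * l) ∪ Set.Icc a (a + 20 * l) := by
      intro t ht
      by_cases h : t ≤ 2 * l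
      · exact Or.inl ⟨ht.1, h⟩
      · push Not at h
        refine Or.inr ⟨csInf_le hbdd ⟨ht, h.le⟩, ?_⟩
        have : t - 20 * l ≤ a := by
          apply le_csInf hne
          rintro s ⟨hs, hs2⟩
          by_cases hst : s ≤ t
          · linarith [key s t hs ht hs2 hst]
          · linarith
        linarith
    calc volume S ≤ _ := measure_mono hsub
      _ ≤ _ := measure_union_le _ _
      _ = ENNReal.ofReal (22 * l) := by
        rw [Real.volume_Icc, Real.volume_Icc, ← ENNReal.ofReal_add (by linarith) (by linarith)]
        congr 1; ring
  · have hsub : S ⊆ Set.Icc 0 (2 * l) := by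
      intro t ht
      by_contra h
      exact hne ⟨t, ht, by
        by_contra h'
        exact h ⟨ht.1, (not_le.1 h').le⟩⟩
    calc volume S ≤ _ := measure_mono hsub
      _ = ENNReal.ofReal (2 * l) := by simp
      _ ≤ _ := ENNReal.ofReal_le_ofReal (by linarith)

noncomputable def moserC : ℝ := ∑' k : ℕ, Real.exp (-k) * (22 * (k + 1))

lemma moserC_summable : Summable (fun k : ℕ => Real.exp (-k) * (22 * ((k:ℝ) + 1))) := by
  have h1 := Real.summable_pow_mul_exp_neg_nat_mul 1 (r := 1) one_pos
  have h0 := Real.summable_pow_mul_exp_neg_nat_mul 0 (r := 1) one_pos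
  refine ((h1.add h0).mul_left 22).congr ?_
  intro k
  simp
  ring

lemma moser (H E : ℝ → ℝ) (hHm : Measurable H) (hE1 : ∀ t, 0 ≤ t → E t ≤ 1)
    (hH : ∀ t, 0 ≤ t → H t ^ 2 ≤ E t * (t + 8))
    (hd : ∀ s t, 0 ≤ s → s ≤ t → (H t - H s) ^ 2 ≤ (t - s) * (E t - E s)) :
    ∫⁻ t in Set.Ioi (0:ℝ), ENNReal.ofReal (Real.exp (H t ^ 2 - (t + 8))) ≤
      ENNReal.ofReal moserC := by
  set S : ℕ → Set ℝ := fun k => {t : ℝ | 0 ≤ t ∧ t + 8 - H t ^ 2 ≤ k + 1} with hS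
  have hSm : ∀ k, MeasurableSet (S k) := by
    intro k
    apply MeasurableSet.inter
    · exact measurableSet_Ici
    · exact measurableSet_le (f := fun t => t + 8 - H t ^ 2) (g := fun _ => (k:ℝ) + 1)
        (by fun_prop) (by fun_prop)
  have hpt : ∀ t ∈ Set.Ioi (0:ℝ), ENNReal.ofReal (Real.exp (H t ^ 2 - (t + 8))) ≤
      ∑' k : ℕ, (S k).indicator (fun _ => ENNReal.ofReal (Real.exp (-(k:ℝ)))) t := by
    intro t ht
    have ht0 : 0 ≤ t := le_of_lt ht
    have hm : 0 ≤ t + 8 - H t ^ 2 := by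
      have := hH t ht0
      have := hE1 t ht0
      nlinarith
    set k := ⌊t + 8 - H t ^ 2⌋₊
    refine le_trans ?_ (ENNReal.le_tsum k)
    rw [Set.indicator_of_mem (show t ∈ S k from ⟨ht0, (Nat.lt_floor_add_one _).le⟩)]
    apply ENNReal.ofReal_le_ofReal
    apply Real.exp_le_exp.2
    have := Nat.floor_le hm
    linarith
  calc _ ≤ ∫⁻ t in Set.Ioi (0:ℝ), ∑' k : ℕ, (S k).indicator (fun _ => ENNReal.ofReal (Real.exp (-(k:ℝ)))) t :=
        setLIntegral_mono' measurableSet_Ioi hpt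
    _ ≤ ∫⁻ t, ∑' k : ℕ, (S k).indicator (fun _ => ENNReal.ofReal (Real.exp (-(k:ℝ)))) t :=
        setLIntegral_le_lintegral _ _
    _ = ∑' k : ℕ, ∫⁻ t, (S k).indicator (fun _ => ENNReal.ofReal (Real.exp (-(k:ℝ)))) t := by
        rw [lintegral_tsum]
        intro k
        exact (measurable_const.indicator (hSm k)).aemeasurable
    _ ≤ ∑' k : ℕ, ENNReal.ofReal (Real.exp (-k) * (22 * ((k:ℝ) + 1))) := by
        apply ENNReal.tsum_le_tsum
        intro k
        rw [lintegral_indicator_const (hSm k), ENNReal.ofReal_mul (by positivity)]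
        gcongr
        exact level_set H E hE1 hH hd _ (by positivity)
    _ = ENNReal.ofReal moserC := by
        rw [moserC, ENNReal.ofReal_tsum_of_nonneg (fun k => by positivity) moserC_summable]

lemma rellich1 (U : ℝ → ℝ) (hU : ContDiff ℝ 2 U) :
    4 * ∫ r in (0:ℝ)..1, r * deriv U r ^ 2 ≤
      ∫ r in (0:ℝ)..1, r * (r * deriv (deriv U) r + 3 * deriv U r) ^ 2 := by
  have c1 : ContDiff ℝ 1 (deriv U) := by
    have := (contDiff_succ_iff_deriv (n := 1) (f := U)).1 (by simpa [one_add_one_eq_two] using hU)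
    exact this.2.2
  have hc1 : Continuous (deriv U) := c1.continuous
  have hc2 : Continuous (deriv (deriv U)) := c1.continuous_deriv le_rfl
  have hD : ∀ r, HasDerivAt (deriv U) (deriv (deriv U) r) r := fun r =>
    (c1.differentiable (by simp) r).hasDerivAt
  have hF : ∀ r ∈ Set.uIcc (0:ℝ) 1, HasDerivAt (fun r => 2 * r ^ 2 * deriv U r ^ 2)
      (4 * r * deriv U r ^ 2 + 4 * r ^ 2 * (deriv U r * deriv (deriv U) r)) r := by
    intro r _
    convert! (((hasDerivAt_pow 2 r).const_mul 2).mul ((hD r).pow 2)) using 1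
    simp
    ring
  have hI := intervalIntegral.integral_eq_sub_of_hasDerivAt hF
    (Continuous.intervalIntegrable (by fun_prop) _ _)
  have hle : ∫ r in (0:ℝ)..1, (4 * (r * deriv U r ^ 2) +
      (4 * r * deriv U r ^ 2 + 4 * r ^ 2 * (deriv U r * deriv (deriv U) r))) ≤
      ∫ r in (0:ℝ)..1, r * (r * deriv (deriv U) r + 3 * deriv U r) ^ 2 := by
    apply intervalIntegral.integral_mono_on zero_le_one
    · exact Continuous.intervalIntegrable (by fun_prop) _ _
    · exact Continuous.intervalIntegrable (by fun_prop) _ _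
    · intro r hr
      have := mul_nonneg hr.1 (sq_nonneg (r * deriv (deriv U) r + deriv U r))
      nlinarith
  rw [intervalIntegral.integral_add (Continuous.intervalIntegrable (by fun_prop) _ _)
    (Continuous.intervalIntegrable (by fun_prop) _ _), hI, intervalIntegral.integral_const_mul] at hle
  norm_num at hle
  nlinarith [sq_nonneg (deriv U 1)]

lemma outer_pt (U : ℝ → ℝ) (hU : ContDiff ℝ 1 U) (M : ℝ) (hUM : ∀ r, M ≤ r → U r = 0)
    (r : ℝ) (hr1 : 1 ≤ r) (hrM : r ≤ M) :
    r ^ 2 * U r ^ 2 ≤ (1 / 2) * ∫ s in (1:ℝ)..M, s ^ 3 * deriv U s ^ 2 := by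
  have hc1 : Continuous (deriv U) := hU.continuous_deriv le_rfl
  have hD : ∀ r, HasDerivAt U (deriv U r) r := fun r =>
    (hU.differentiable (by simp) r).hasDerivAt
  have hpos : ∀ s ∈ Set.Icc r M, s ≠ 0 := fun s hs => by have := hs.1; intro h; linarith
  have hI := intervalIntegral.integral_eq_sub_of_hasDerivAt (a := r) (b := M) (fun r _ => hD r)
    (Continuous.intervalIntegrable (by fun_prop) _ _)
  rw [hUM M le_rfl, zero_sub] at hI
  have hcs := cs_interval hrM (f := fun s => (s * √s) * deriv U s) (g := fun s => (s * √s)⁻¹)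
    (by fun_prop) (by
      apply ContinuousOn.inv₀ (by fun_prop)
      intro s hs
      have : 0 < s := by linarith [hs.1]
      positivity)
  have e1 : ∫ s in r..M, (s * √s) * deriv U s * (s * √s)⁻¹ = ∫ s in r..M, deriv U s := by
    apply intervalIntegral.integral_congr
    intro s hs
    rw [Set.uIcc_of_le hrM] at hs
    have : 0 < s := by linarith [hs.1]
    have : 0 < √s := by positivity
    field_simp
  have e2 : ∫ s in r..M, ((s * √s) * deriv U s) ^ 2 = ∫ s in r..M, s ^ 3 * deriv U s ^ 2 := by
    apply intervalIntegral.integral_congr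
    intro s hs
    rw [Set.uIcc_of_le hrM] at hs
    have : 0 ≤ s := by linarith [hs.1]
    simp only
    rw [mul_pow, mul_pow, Real.sq_sqrt this]; ring
  have e3 : ∫ s in r..M, ((s * √s)⁻¹) ^ 2 = 1 / (2 * r ^ 2) - 1 / (2 * M ^ 2) := by
    have hG : ∀ s ∈ Set.uIcc r M, HasDerivAt (fun s : ℝ => -(1 / 2) * (s ^ 2)⁻¹)
        (((s * √s)⁻¹) ^ 2) s := by
      intro s hs
      rw [Set.uIcc_of_le hrM] at hs
      have h0 : 0 < s := by linarith [hs.1]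
      convert! ((hasDerivAt_pow 2 s).inv (by positivity)).const_mul (-(1 / 2)) using 1
      rw [inv_pow, mul_pow, Real.sq_sqrt h0.le]
      field_simp
      norm_num
      ring
    rw [intervalIntegral.integral_eq_sub_of_hasDerivAt hG]
    · field_simp; ring
    · apply ContinuousOn.intervalIntegrable
      rw [Set.uIcc_of_le hrM]
      apply ContinuousOn.pow
      apply ContinuousOn.inv₀ (by fun_prop)
      intro s hs
      have : 0 < s := by linarith [hs.1]
      positivity
  rw [e1, e2, e3, hI] at hcs
  have hmono : ∫ s in r..M, s ^ 3 * deriv U s ^ 2 ≤ ∫ s in (1:ℝ)..M, s ^ 3 * deriv U s ^ 2 := by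
    apply intervalIntegral.integral_mono_interval hr1 hrM le_rfl
    · filter_upwards [ae_restrict_mem measurableSet_Ioc] with s hs
      have : 0 ≤ s := by linarith [hs.1]
      simp only [Pi.zero_apply]
      positivity
    · exact Continuous.intervalIntegrable (by fun_prop) _ _
  have hn : 0 ≤ ∫ s in r..M, s ^ 3 * deriv U s ^ 2 := by
    apply intervalIntegral.integral_nonneg hrM
    intro s hs
    have : 0 ≤ s := by linarith [hs.1]
    positivity
  have hr0 : 0 < r := by linarith
  have : (1 / (2 * r ^ 2) - 1 / (2 * M ^ 2)) ≤ 1 / (2 * r ^ 2) := by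
    have : 0 ≤ 1 / (2 * M ^ 2) := by positivity
    linarith
  calc r ^ 2 * U r ^ 2 = r ^ 2 * (- U r) ^ 2 := by ring
    _ ≤ r ^ 2 * ((∫ s in (1:ℝ)..M, s ^ 3 * deriv U s ^ 2) * (1 / (2 * r ^ 2))) := by
      gcongr
      refine hcs.trans ?_
      refine (mul_le_mul_of_nonneg_left this hn).trans ?_
      gcongr
    _ = _ := by field_simp

lemma hardy_out (U : ℝ → ℝ) (hU : ContDiff ℝ 1 U) (M : ℝ) (hM : 1 ≤ M)
    (hUM : ∀ r, M ≤ r → U r = 0) :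
    ∫ s in (1:ℝ)..M, s * U s ^ 2 ≤ ∫ s in (1:ℝ)..M, s ^ 3 * deriv U s ^ 2 := by
  have hc1 : Continuous (deriv U) := hU.continuous_deriv le_rfl
  have hc0 : Continuous U := hU.continuous
  have hD : ∀ r, HasDerivAt U (deriv U r) r := fun r =>
    (hU.differentiable (by simp) r).hasDerivAt
  have hF : ∀ r ∈ Set.uIcc (1:ℝ) M, HasDerivAt (fun r => r ^ 2 * U r ^ 2)
      (2 * r * U r ^ 2 + 2 * r ^ 2 * (U r * deriv U r)) r := by
    intro r _
    convert! ((hasDerivAt_pow 2 r).mul ((hD r).pow 2)) using 1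
    simp
    ring
  have hI := intervalIntegral.integral_eq_sub_of_hasDerivAt hF
    (Continuous.intervalIntegrable (by fun_prop) _ _)
  have hle : ∫ r in (1:ℝ)..M, r * U r ^ 2 ≤
     ∫ r in (1:ℝ)..M, ((2 * r * U r ^ 2 + 2 * r ^ 2 * (U r * deriv U r)) + r ^ 3 * deriv U r ^ 2) := by
    apply intervalIntegral.integral_mono_on hM
    · exact Continuous.intervalIntegrable (by fun_prop) _ _
    · exact Continuous.intervalIntegrable (by fun_prop) _ _
    · intro r hr
      have h0 : 0 ≤ r := by linarith [hr.1]
      have := mul_nonneg h0 (sq_nonneg (U r + r * deriv U r))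
      nlinarith
  rw [intervalIntegral.integral_add (Continuous.intervalIntegrable (by fun_prop) _ _)
    (Continuous.intervalIntegrable (by fun_prop) _ _), hI, hUM M le_rfl] at hle
  norm_num at hle
  nlinarith [sq_nonneg (U 1)]

lemma exp_bound {x : ℝ} (h0 : 0 ≤ x) (h8 : x ≤ 8) :
    Real.exp x - 1 - x ≤ Real.exp 8 * x ^ 2 := by
  have h := Real.add_one_le_exp (-x)
  have hm : Real.exp x * Real.exp (-x) = 1 := by rw [← Real.exp_add]; simp
  have h1 : Real.exp x * (1 - x) ≤ 1 := by
    rw [← hm]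
    have := Real.exp_pos x
    gcongr
    linarith
  have h2 : Real.exp x * (1 - x) * (1 + x) ≤ 1 * (1 + x) := by gcongr
  have : Real.exp x ≤ Real.exp 8 := Real.exp_le_exp.2 h8
  nlinarith [sq_nonneg x]

noncomputable def Phi (x : ℝ) : ℝ := Real.exp (32 * π ^ 2 * x ^ 2) - 1 - 32 * π ^ 2 * x ^ 2

lemma Phi_nonneg (x : ℝ) : 0 ≤ Phi x := by
  unfold Phi
  linarith [Real.add_one_le_exp (32 * π ^ 2 * x ^ 2)]

lemma Phi_cont : Continuous Phi := by unfold Phi; fun_prop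

noncomputable def outC : ℝ := Real.exp 8 * (32 * π ^ 2) ^ 2 

lemma outer_int (U : ℝ → ℝ) (hU : ContDiff ℝ 1 U) (M : ℝ) (hM : 1 ≤ M)
    (hUM : ∀ r, M ≤ r → U r = 0)
    (hb : 2 * π ^ 2 * ∫ s in (1:ℝ)..M, s ^ 3 * deriv U s ^ 2 ≤ 1) :
    ∫⁻ r in Set.Ioi (1:ℝ), ENNReal.ofReal (r ^ 3) * ENNReal.ofReal (Phi (U r)) ≤
      ENNReal.ofReal outC := by
  have hc0 : Continuous U := hU.continuous
  have hpi : 1 ≤ 2 * π ^ 2 := by nlinarith [Real.pi_gt_three]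
  set B := ∫ s in (1:ℝ)..M, s ^ 3 * deriv U s ^ 2 with hB
  have hBn : 0 ≤ B := by
    apply intervalIntegral.integral_nonneg hM
    intro s hs
    have : 0 ≤ s := by linarith [hs.1]
    positivity
  have hB1 : B ≤ 1 := by nlinarith
  have hpt : ∀ r ∈ Set.Ioi (1:ℝ), ENNReal.ofReal (r ^ 3) * ENNReal.ofReal (Phi (U r)) ≤
      (Set.Ioc 1 M).indicator (fun r => ENNReal.ofReal (outC * (r * U r ^ 2))) r := by
    intro r hr
    have hr : 1 < r := hr
    have hr0 : 0 < r := by linarith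
    by_cases h : r ≤ M
    · rw [Set.indicator_of_mem (show r ∈ Set.Ioc 1 M from ⟨hr, h⟩),
        ← ENNReal.ofReal_mul (by positivity)]
      apply ENNReal.ofReal_le_ofReal
      have h1 := outer_pt U hU M hUM r hr.le h
      rw [← hB] at h1
      have h3 : r ^ 2 * U r ^ 2 ≤ 1 := by linarith
      have h2 : U r ^ 2 ≤ r ^ 2 * U r ^ 2 :=
        le_mul_of_one_le_left (sq_nonneg _) (by nlinarith)
      have h4 : 32 * π ^ 2 * U r ^ 2 ≤ 8 := by
        have : π ^ 2 * U r ^ 2 ≤ π ^ 2 * (1 / 2 * B) := by gcongr; linarith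
        linarith
      have h5 := exp_bound (by positivity) h4
      unfold Phi outC
      calc r ^ 3 * (Real.exp (32 * π ^ 2 * U r ^ 2) - 1 - 32 * π ^ 2 * U r ^ 2)
          ≤ r ^ 3 * (Real.exp 8 * (32 * π ^ 2 * U r ^ 2) ^ 2) := by gcongr
        _ = Real.exp 8 * (32 * π ^ 2) ^ 2 * (r * U r ^ 2) * (r ^ 2 * U r ^ 2) := by ring
        _ ≤ Real.exp 8 * (32 * π ^ 2) ^ 2 * (r * U r ^ 2) * 1 := by gcongr
        _ = _ := by ring
    · rw [hUM r (by linarith)]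
      simp [Phi]
  calc _ ≤ ∫⁻ r in Set.Ioi (1:ℝ), (Set.Ioc 1 M).indicator (fun r => ENNReal.ofReal (outC * (r * U r ^ 2))) r :=
        setLIntegral_mono' measurableSet_Ioi hpt
    _ ≤ ∫⁻ r, (Set.Ioc 1 M).indicator (fun r => ENNReal.ofReal (outC * (r * U r ^ 2))) r :=
        setLIntegral_le_lintegral _ _
    _ = ∫⁻ r in Set.Ioc 1 M, ENNReal.ofReal (outC * (r * U r ^ 2)) := by
        rw [lintegral_indicator measurableSet_Ioc]
    _ = ENNReal.ofReal (∫ r in (1:ℝ)..M, outC * (r * U r ^ 2)) := by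
        rw [intervalIntegral.integral_of_le hM, ofReal_integral_eq_lintegral_ofReal]
        · exact (Continuous.integrableOn_Icc (by fun_prop)).mono_set Set.Ioc_subset_Icc_self
        · filter_upwards [ae_restrict_mem measurableSet_Ioc] with r hr
          have : 0 ≤ r := by linarith [hr.1]
          simp only [Pi.zero_apply]
          unfold outC
          positivity
    _ ≤ ENNReal.ofReal outC := by
        apply ENNReal.ofReal_le_ofReal
        rw [intervalIntegral.integral_const_mul]
        have := hardy_out U hU M hM hUM
        have h0 : 0 ≤ outC := by unfold outC; positivity
        nlinarith

lemma inner_int (U : ℝ → ℝ) (hU : ContDiff ℝ 1 U) (d : ℝ) (h1 : U 1 ^ 2 * (4 * π ^ 2) ≤ d)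
    (hb : d + 8 * π ^ 2 * ∫ s in (0:ℝ)..1, s * deriv U s ^ 2 ≤ 1) :
    ∫⁻ r in Set.Ioo (0:ℝ) 1, ENNReal.ofReal (r ^ 3) * ENNReal.ofReal (Phi (U r)) ≤
      ENNReal.ofReal (Real.exp 8 * moserC) := by
  have hc1 : Continuous (deriv U) := hU.continuous_deriv le_rfl
  have hc0 : Continuous U := hU.continuous
  have hD : ∀ r, HasDerivAt U (deriv U r) r := fun r =>
    (hU.differentiable (by simp) r).hasDerivAt
  set ρ : ℝ → ℝ := fun t => Real.exp (-t / 4) with hρ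
  have hρpos : ∀ t, 0 < ρ t := fun t => Real.exp_pos _
  have hρ0 : ρ 0 = 1 := by simp [hρ]
  have hρanti : ∀ s t, s ≤ t → ρ t ≤ ρ s := fun s t h => Real.exp_le_exp.2 (by linarith)
  have hρlog : ∀ t, Real.log (ρ t) = -t / 4 := fun t => Real.log_exp _
  set H : ℝ → ℝ := fun t => √32 * π * U (ρ t) with hH
  set E : ℝ → ℝ := fun t => d + 8 * π ^ 2 * ∫ s in (ρ t)..1, s * deriv U s ^ 2 with hE
  have hd0 : 0 ≤ d := le_trans (by positivity) h1
  have hdiff : ∀ s t, 0 ≤ s → s ≤ t → (H t - H s) ^ 2 ≤ (t - s) * (E t - E s) := by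
    intro s t hs hst
    have hle := hρanti s t hst
    have e0 : E t - E s = 8 * π ^ 2 * ∫ x in (ρ t)..(ρ s), x * deriv U x ^ 2 := by
      have := intervalIntegral.integral_add_adjacent_intervals (μ := volume) (a := ρ t) (b := ρ s) (c := 1)
        (f := fun x => x * deriv U x ^ 2)
        (Continuous.intervalIntegrable (by fun_prop) _ _)
        (Continuous.intervalIntegrable (by fun_prop) _ _)
      simp only [hE]
      rw [← this]; ring
    have hI := intervalIntegral.integral_eq_sub_of_hasDerivAt (a := ρ t) (b := ρ s) (fun r _ => hD r)
      (Continuous.intervalIntegrable (by fun_prop) _ _)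
    have hcs := cs_interval hle (f := fun s => √s * deriv U s) (g := fun s => (√s)⁻¹)
      (by fun_prop) (by
        apply ContinuousOn.inv₀ (by fun_prop)
        intro x hx
        have : 0 < x := lt_of_lt_of_le (hρpos t) hx.1
        positivity)
    have e1 : ∫ x in (ρ t)..(ρ s), √x * deriv U x * (√x)⁻¹ = ∫ x in (ρ t)..(ρ s), deriv U x := by
      apply intervalIntegral.integral_congr
      intro x hx
      rw [Set.uIcc_of_le hle] at hx
      have : 0 < x := lt_of_lt_of_le (hρpos t) hx.1
      have : 0 < √x := by positivity
      field_simp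
    have e2 : ∫ x in (ρ t)..(ρ s), (√x * deriv U x) ^ 2 = ∫ x in (ρ t)..(ρ s), x * deriv U x ^ 2 := by
      apply intervalIntegral.integral_congr
      intro x hx
      rw [Set.uIcc_of_le hle] at hx
      have : 0 < x := lt_of_lt_of_le (hρpos t) hx.1
      simp only
      rw [mul_pow, Real.sq_sqrt this.le]
    have e3 : ∫ x in (ρ t)..(ρ s), ((√x)⁻¹) ^ 2 = (t - s) / 4 := by
      have : ∫ x in (ρ t)..(ρ s), ((√x)⁻¹) ^ 2 = ∫ x in (ρ t)..(ρ s), x⁻¹ := by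
        apply intervalIntegral.integral_congr
        intro x hx
        rw [Set.uIcc_of_le hle] at hx
        have : 0 < x := lt_of_lt_of_le (hρpos t) hx.1
        simp only
        rw [inv_pow, Real.sq_sqrt this.le]
      rw [this, integral_inv_of_pos (hρpos t) (hρpos s),
        Real.log_div (hρpos s).ne' (hρpos t).ne', hρlog, hρlog]
      ring
    rw [e1, e2, e3, hI] at hcs
    rw [e0]
    calc (H t - H s) ^ 2 = (√32) ^ 2 * π ^ 2 * (U (ρ s) - U (ρ t)) ^ 2 := by simp only [hH]; ring
      _ = 32 * π ^ 2 * (U (ρ s) - U (ρ t)) ^ 2 := by rw [Real.sq_sqrt (by norm_num)]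
      _ ≤ 32 * π ^ 2 * ((∫ x in (ρ t)..(ρ s), x * deriv U x ^ 2) * ((t - s) / 4)) := by gcongr
      _ = _ := by ring
  have hE0 : E 0 = d := by simp [hE, hρ0]
  have hH0 : H 0 ^ 2 ≤ 8 * d := by
    simp only [hH, hρ0]
    rw [mul_pow, mul_pow, Real.sq_sqrt (by norm_num)]
    linarith
  have hHE : ∀ t, 0 ≤ t → H t ^ 2 ≤ E t * (t + 8) := by
    intro t ht
    have h := hdiff 0 t le_rfl ht
    rw [hE0, sub_zero] at h
    set e := E t - d with he
    have hEt : E t = d + e := by rw [he]; ring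
    have hen : 0 ≤ e := by
      have : 0 ≤ ∫ s in (ρ t)..1, s * deriv U s ^ 2 := by
        apply intervalIntegral.integral_nonneg (by simpa [hρ0] using hρanti 0 t ht)
        intro x hx
        have : 0 < x := lt_of_lt_of_le (hρpos t) hx.1
        positivity
      simp only [he, hE]
      have := mul_nonneg (show 0 ≤ 8 * π ^ 2 by positivity) this
      linarith
    rw [hEt]
    have hcross : 2 * (H 0 * (H t - H 0)) ≤ t * d + 8 * e := by
      have hp : (H 0 * (H t - H 0)) ^ 2 ≤ 8 * d * (t * e) := by
        rw [mul_pow]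
        gcongr
      apply le_of_sq_le_sq _ (by positivity)
      nlinarith [sq_nonneg (t * d - 8 * e)]
    nlinarith
  have hE1 : ∀ t, 0 ≤ t → E t ≤ 1 := by
    intro t ht
    refine le_trans ?_ hb
    simp only [hE]
    gcongr
    apply intervalIntegral.integral_mono_interval (hρpos t).le
      (by simpa [hρ0] using hρanti 0 t ht) le_rfl
    · filter_upwards [ae_restrict_mem measurableSet_Ioc] with s hs
      have : 0 ≤ s := by linarith [hs.1]
      simp only [Pi.zero_apply]
      positivity
    · exact Continuous.intervalIntegrable (by fun_prop) _ _
  have hmos := moser H E (by simp only [hH, hρ]; fun_prop) hE1 hHE hdiff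
  have himg : Set.Ioo (0:ℝ) 1 = ρ '' Set.Ioi 0 := by
    ext r
    constructor
    · rintro ⟨h0, h1⟩
      refine ⟨-4 * Real.log r, ?_, ?_⟩
      · have := Real.log_neg h0 h1
        simp only [Set.mem_Ioi]; linarith
      · simp only [hρ]
        rw [show -(-4 * Real.log r) / 4 = Real.log r by ring, Real.exp_log h0]
    · rintro ⟨t, ht, rfl⟩
      have ht : 0 < t := ht
      exact ⟨hρpos t, by simp only [hρ]; rw [Real.exp_lt_one_iff]; linarith⟩
  have hρd : ∀ t ∈ Set.Ioi (0:ℝ), HasDerivWithinAt ρ (ρ t * (-1 / 4)) (Set.Ioi 0) t := by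
    intro t _
    apply HasDerivAt.hasDerivWithinAt
    exact (((hasDerivAt_id t).neg).div_const 4).exp
  have hinj : Set.InjOn ρ (Set.Ioi 0) := by
    intro s _ t _ h
    have := Real.exp_injective h
    linarith
  rw [himg, lintegral_image_eq_lintegral_abs_deriv_mul measurableSet_Ioi hρd hinj]
  calc _ ≤ ∫⁻ t in Set.Ioi (0:ℝ), ENNReal.ofReal (Real.exp 8) *
        ENNReal.ofReal (Real.exp (H t ^ 2 - (t + 8))) := by
        apply setLIntegral_mono' measurableSet_Ioi
        intro t ht
        have hp := hρpos t
        rw [← ENNReal.ofReal_mul (by positivity), ← ENNReal.ofReal_mul (by positivity),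
          ← ENNReal.ofReal_mul (by positivity)]
        apply ENNReal.ofReal_le_ofReal
        rw [abs_mul, abs_of_pos hp, ← Real.exp_add]
        have hphi : Phi (U (ρ t)) ≤ Real.exp (H t ^ 2) := by
          have : H t ^ 2 = 32 * π ^ 2 * U (ρ t) ^ 2 := by
            simp only [hH]
            rw [mul_pow, mul_pow, Real.sq_sqrt (by norm_num)]
          rw [this, Phi]
          have : 0 ≤ 32 * π ^ 2 * U (ρ t) ^ 2 := by positivity
          linarith
        have h4 : ρ t ^ 4 = Real.exp (-t) := by
          simp only [hρ]
          rw [← Real.exp_nat_mul]; congr 1; push_cast; ring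
        have h14 : |(-1 / 4 : ℝ)| ≤ 1 := by norm_num [abs_le]
        calc ρ t * |(-1 / 4 : ℝ)| * (ρ t ^ 3 * Phi (U (ρ t)))
            ≤ ρ t * 1 * (ρ t ^ 3 * Real.exp (H t ^ 2)) := by
              have := Phi_nonneg (U (ρ t))
              gcongr
          _ = ρ t ^ 4 * Real.exp (H t ^ 2) := by ring
          _ = _ := by rw [h4, ← Real.exp_add]; congr 1; ring
    _ = ENNReal.ofReal (Real.exp 8) * ∫⁻ t in Set.Ioi (0:ℝ),
        ENNReal.ofReal (Real.exp (H t ^ 2 - (t + 8))) := by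
        rw [lintegral_const_mul]
        simp only [hH, hρ]; fun_prop
    _ ≤ ENNReal.ofReal (Real.exp 8) * ENNReal.ofReal moserC := by gcongr
    _ = _ := by rw [← ENNReal.ofReal_mul (by positivity)]

lemma norm_line {V : Type*} [NormedAddCommGroup V] [InnerProductSpace ℝ V] (y v : V) (hy : y ≠ 0) :
    HasDerivAt (fun s : ℝ => ‖y + s • v‖) (inner ℝ y v / ‖y‖) 0 := by
  have h1 : HasDerivAt (fun s : ℝ => y + s • v) v 0 := by
    simpa using ((hasDerivAt_id (0:ℝ)).smul_const v).const_add y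
  have h2 := h1.norm_sq.sqrt (by simpa using hy)
  simp only [Real.sqrt_sq (norm_nonneg _)] at h2
  convert! h2 using 1
  simp
  field_simp

lemma radial_fderiv {V : Type*} [NormedAddCommGroup V] [InnerProductSpace ℝ V]
    (u : V → ℝ) (U : ℝ → ℝ) (hu : Differentiable ℝ u) (hU : Differentiable ℝ U)
    (huU : ∀ x, u x = U ‖x‖) (y v : V) (hy : y ≠ 0) :
    fderiv ℝ u y v = deriv U ‖y‖ * (inner ℝ y v / ‖y‖) := by
  have h1 : HasDerivAt (fun s : ℝ => y + s • v) v 0 := by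
    simpa using ((hasDerivAt_id (0:ℝ)).smul_const v).const_add y
  have ha : HasDerivAt (fun s : ℝ => u (y + s • v)) (fderiv ℝ u y v) 0 := by
    have hf : HasFDerivAt u (fderiv ℝ u y) (y + (0:ℝ) • v) := by
      simpa using (hu y).hasFDerivAt
    exact hf.comp_hasDerivAt 0 h1
  have hb : HasDerivAt (fun s : ℝ => u (y + s • v)) (deriv U ‖y‖ * (inner ℝ y v / ‖y‖)) 0 := by
    simp only [huU]
    have hf : HasDerivAt U (deriv U ‖y‖) ‖y + (0:ℝ) • v‖ := by
      simpa using (hU ‖y‖).hasDerivAt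
    exact HasDerivAt.comp (0:ℝ) hf (norm_line y v hy)
  exact ha.unique hb

lemma radial_second {V : Type*} [NormedAddCommGroup V] [InnerProductSpace ℝ V]
    (u : V → ℝ) (U : ℝ → ℝ) (hu : ContDiff ℝ 2 u) (hU : Differentiable ℝ U)
    (hU2 : Differentiable ℝ (deriv U))
    (huU : ∀ x, u x = U ‖x‖) (y v : V) (hy : y ≠ 0) :
    fderiv ℝ (fderiv ℝ u) y v v = deriv (deriv U) ‖y‖ * (inner ℝ y v / ‖y‖) ^ 2
      + deriv U ‖y‖ * (‖v‖ ^ 2 / ‖y‖ - (inner ℝ y v) ^ 2 / ‖y‖ ^ 3) := by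
  have h1 : HasDerivAt (fun s : ℝ => y + s • v) v 0 := by
    simpa using ((hasDerivAt_id (0:ℝ)).smul_const v).const_add y
  have hny : 0 < ‖y‖ := norm_pos_iff.2 hy
  have hdf : Differentiable ℝ (fderiv ℝ u) := (hu.fderiv_right (m := 1) (by norm_num)).differentiable (by simp)
  have ha : HasDerivAt (fun s : ℝ => fderiv ℝ u (y + s • v) v) (fderiv ℝ (fderiv ℝ u) y v v) 0 := by
    have hf : HasFDerivAt (fderiv ℝ u) (fderiv ℝ (fderiv ℝ u) y) (y + (0:ℝ) • v) := by
      simpa using (hdf y).hasFDerivAt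
    have := hf.comp_hasDerivAt (0:ℝ) h1
    have h2 := this.clm_apply (hasDerivAt_const (0:ℝ) v)
    simpa using h2
  have hb : HasDerivAt (fun s : ℝ => deriv U ‖y + s • v‖ * (inner ℝ (y + s • v) v / ‖y + s • v‖))
     (deriv (deriv U) ‖y‖ * (inner ℝ y v / ‖y‖) ^ 2
      + deriv U ‖y‖ * (‖v‖ ^ 2 / ‖y‖ - (inner ℝ y v) ^ 2 / ‖y‖ ^ 3)) 0 := by
    have hf : HasDerivAt (deriv U) (deriv (deriv U) ‖y‖) ‖y + (0:ℝ) • v‖ := by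
      simpa using (hU2 ‖y‖).hasDerivAt
    have hi : HasDerivAt (fun s : ℝ => inner ℝ (y + s • v) v) (‖v‖ ^ 2) 0 := by
      have := h1.inner ℝ (hasDerivAt_const (0:ℝ) v)
      simpa using this
    have hn := norm_line y v hy
    have := (HasDerivAt.comp (0:ℝ) hf hn).mul (hi.div hn (by simpa using hy))
    convert! this using 1
    simp
    field_simp
  have heq : (fun s : ℝ => fderiv ℝ u (y + s • v) v) =ᶠ[nhds 0]
      (fun s : ℝ => deriv U ‖y + s • v‖ * (inner ℝ (y + s • v) v / ‖y + s • v‖)) := by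
    have : ∀ᶠ s : ℝ in nhds 0, y + s • v ≠ 0 :=
      h1.continuousAt.eventually_ne (by simpa using hy)
    filter_upwards [this] with s hs
    exact radial_fderiv u U (hu.differentiable (by simp)) hU huU _ v hs
  exact ha.unique (hb.congr_of_eventuallyEq heq)

lemma radial_laplacian (u : EuclideanSpace ℝ (Fin 4) → ℝ) (U : ℝ → ℝ) (hu : ContDiff ℝ 2 u)
    (hU : Differentiable ℝ U) (hU2 : Differentiable ℝ (deriv U))
    (huU : ∀ x, u x = U ‖x‖) (y : EuclideanSpace ℝ (Fin 4)) (hy : y ≠ 0) :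
    laplacian u y = deriv (deriv U) ‖y‖ + 3 * deriv U ‖y‖ / ‖y‖ := by
  have hny : 0 < ‖y‖ := norm_pos_iff.2 hy
  unfold laplacian
  simp_rw [radial_second u U hu hU hU2 huU y _ hy]
  have hn : ‖y‖ ^ 2 = y 0 ^ 2 + y 1 ^ 2 + y 2 ^ 2 + y 3 ^ 2 := by
    rw [EuclideanSpace.real_norm_sq_eq, Fin.sum_univ_four]
  simp [Fin.sum_univ_four, EuclideanSpace.inner_single_right]
  field_simp
  linear_combination (deriv U ‖y‖ - deriv (deriv U) ‖y‖ * ‖y‖) * hn 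

lemma radial_grad (u : EuclideanSpace ℝ (Fin 4) → ℝ) (U : ℝ → ℝ) (hu : Differentiable ℝ u)
    (hU : Differentiable ℝ U)
    (huU : ∀ x, u x = U ‖x‖) (y : EuclideanSpace ℝ (Fin 4)) (hy : y ≠ 0) :
    |deriv U ‖y‖| ≤ ‖gradient u y‖ := by
  have hny : 0 < ‖y‖ := norm_pos_iff.2 hy
  have h := radial_fderiv u U hu hU huU y y hy
  have h2 : ‖fderiv ℝ u y‖ = ‖gradient u y‖ := by
    rw [← toDual_gradient, LinearIsometryEquiv.norm_map]
  have h3 := (fderiv ℝ u y).le_opNorm y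
  rw [h, h2, real_inner_self_eq_norm_sq, sq, mul_div_assoc, div_self hny.ne', mul_one, norm_mul,
    norm_norm] at h3
  exact le_of_mul_le_mul_right h3 hny

lemma sq_eLpNorm {f : EuclideanSpace ℝ (Fin 4) → ℝ} :
    eLpNorm f 2 volume ^ (2:ℝ) = ∫⁻ x, ENNReal.ofReal (f x ^ 2) := by
  have := eLpNorm_nnreal_pow_eq_lintegral (μ := (volume : Measure (EuclideanSpace ℝ (Fin 4))))
    (f := f) (p := 2) (by norm_num)
  simp only [NNReal.coe_ofNat, ENNReal.coe_ofNat] at this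
  rw [this]
  apply lintegral_congr
  intro x
  rw [Real.enorm_eq_ofReal_abs, ENNReal.ofReal_rpow_of_nonneg (abs_nonneg _) (by norm_num)]
  congr 1
  norm_num

lemma lower_polar (f : EuclideanSpace ℝ (Fin 4) → ℝ) (g : ℝ → ℝ) (hg : Measurable g)
    (hfg : ∀ x, x ≠ 0 → g ‖x‖ ≤ f x) (k : ℝ → ℝ) (hk : Continuous k)
    (a b : ℝ) (ha : 0 ≤ a) (hab : a ≤ b) (hk0 : ∀ r, a < r → 0 ≤ k r)
    (hkg : ∀ r, 0 < r → k r = r ^ 3 * g r) :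
    ENNReal.ofReal (2 * π ^ 2 * ∫ r in a..b, k r) ≤ ∫⁻ x, ENNReal.ofReal (f x) := by
  calc ENNReal.ofReal (2 * π ^ 2 * ∫ r in a..b, k r)
      = ENNReal.ofReal (2 * π ^ 2) * ∫⁻ r in Set.Ioc a b, ENNReal.ofReal (k r) := by
        rw [ENNReal.ofReal_mul (by positivity), intervalIntegral.integral_of_le hab,
          ofReal_integral_eq_lintegral_ofReal]
        · exact (Continuous.integrableOn_Icc (by fun_prop)).mono_set Set.Ioc_subset_Icc_self
        · filter_upwards [ae_restrict_mem measurableSet_Ioc] with r hr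
          exact hk0 r hr.1
    _ ≤ ENNReal.ofReal (2 * π ^ 2) * ∫⁻ r in Set.Ioi 0, ENNReal.ofReal (k r) := by
        gcongr
        intro r hr
        exact lt_of_le_of_lt ha hr.1
    _ = ENNReal.ofReal (2 * π ^ 2) * ∫⁻ r in Set.Ioi 0, ENNReal.ofReal (r ^ 3) * ENNReal.ofReal (g r) := by
        congr 1
        apply setLIntegral_congr_fun measurableSet_Ioi
        intro r hr
        have hr : 0 < r := hr
        simp only
        rw [hkg r hr, ENNReal.ofReal_mul (by positivity)]
    _ = ∫⁻ x : EuclideanSpace ℝ (Fin 4), ENNReal.ofReal (g ‖x‖) := by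
        rw [polar4 (fun r => ENNReal.ofReal (g r)) (by fun_prop)]
    _ ≤ ∫⁻ x, ENNReal.ofReal (f x) := by
        apply lintegral_mono_ae
        have : ∀ᵐ x : EuclideanSpace ℝ (Fin 4), x ≠ 0 := by
          simp [ae_iff]
        filter_upwards [this] with x hx
        exact ENNReal.ofReal_le_ofReal (hfg x hx)

theorem stmt_19 :
    ∃ C > (0 : ℝ), ∀ u : EuclideanSpace ℝ (Fin 4) → ℝ,
      ContDiff ℝ (⊤ : ℕ∞) u → HasCompactSupport u →
      (∀ x y : EuclideanSpace ℝ (Fin 4), ‖x‖ = ‖y‖ → u x = u y) →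
      eLpNorm (laplacian u) 2 volume ^ (2 : ℝ)
          + eLpNorm (fun x => ‖gradient u x‖) 2 volume ^ (2 : ℝ) ≤ 1 →
      (∫⁻ x, ENNReal.ofReal
          (Real.exp (32 * π ^ 2 * (u x) ^ 2) - 1 - 32 * π ^ 2 * (u x) ^ 2)) ≤
        ENNReal.ofReal C := by
  have hmC : 0 ≤ moserC := tsum_nonneg (fun k => by positivity)
  have hoC : 0 < outC := by unfold outC; positivity
  refine ⟨2 * π ^ 2 * (Real.exp 8 * moserC + outC), by positivity, ?_⟩
  intro u hu hsupp hrad hnorm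
  set e0 : EuclideanSpace ℝ (Fin 4) := EuclideanSpace.single 0 1 with he0
  have he0n : ‖e0‖ = 1 := by simp [he0]
  set U : ℝ → ℝ := fun r => u (r • e0) with hUdef
  have hu2 : ContDiff ℝ 2 u := hu.of_le (WithTop.coe_le_coe.2 (le_top : (2 : ℕ∞) ≤ ⊤))
  have hU2 : ContDiff ℝ 2 U := hu2.comp (contDiff_id.smul contDiff_const)
  have hU1 : ContDiff ℝ 1 U := hU2.of_le (by norm_num)
  have c1 : ContDiff ℝ 1 (deriv U) := by
    have := (contDiff_succ_iff_deriv (n := 1) (f := U)).1 (by simpa [one_add_one_eq_two] using hU2)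
    exact this.2.2
  have hc0 : Continuous U := hU1.continuous
  have hc1 : Continuous (deriv U) := c1.continuous
  have hc2 : Continuous (deriv (deriv U)) := c1.continuous_deriv le_rfl
  have hUd : Differentiable ℝ U := hU1.differentiable (by simp)
  have hUd2 : Differentiable ℝ (deriv U) := c1.differentiable (by simp)
  have hud : Differentiable ℝ u := hu2.differentiable (by simp)
  have huU : ∀ x, u x = U ‖x‖ := by
    intro x
    apply hrad
    rw [norm_smul, he0n]; simp
  obtain ⟨M, hM1, hUM⟩ : ∃ M : ℝ, 1 ≤ M ∧ ∀ r, M ≤ r → U r = 0 := by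
    obtain ⟨R, hR⟩ := hsupp.isCompact.isBounded.subset_closedBall (0 : EuclideanSpace ℝ (Fin 4))
    refine ⟨max 1 (R + 1), le_max_left _ _, ?_⟩
    intro r hr
    by_contra h
    have h1 : r • e0 ∈ tsupport u := subset_tsupport _ h
    have h2 := hR h1
    rw [mem_closedBall_zero_iff, norm_smul, he0n, mul_one] at h2
    have := le_max_right 1 (R + 1)
    have := le_abs_self r
    rw [Real.norm_eq_abs] at h2
    linarith
  rw [sq_eLpNorm, sq_eLpNorm] at hnorm
  have hL := lower_polar (fun x => laplacian u x ^ 2)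
    (fun r => (deriv (deriv U) r + 3 * deriv U r / r) ^ 2) (by fun_prop)
    (fun x hx => le_of_eq (by simp only [radial_laplacian u U hu2 hUd hUd2 huU x hx]))
    (fun r => r * (r * deriv (deriv U) r + 3 * deriv U r) ^ 2) (by fun_prop) 0 1 le_rfl zero_le_one
    (fun r hr => by positivity) (fun r hr => by field_simp)
  have hG := lower_polar (fun x => ‖gradient u x‖ ^ 2)
    (fun r => deriv U r ^ 2) (by fun_prop)
    (fun x hx => by
      have := radial_grad u U hud hUd huU x hx
      rw [← sq_abs]
      gcongr)
    (fun r => r ^ 3 * deriv U r ^ 2) (by fun_prop) 1 M zero_le_one hM1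
    (fun r hr => by have : 0 < r := by linarith
                    positivity) (fun r hr => rfl)
  have hsum := (add_le_add hL hG).trans hnorm
  have hn1 : 0 ≤ ∫ r in (0:ℝ)..1, r * (r * deriv (deriv U) r + 3 * deriv U r) ^ 2 := by
    apply intervalIntegral.integral_nonneg zero_le_one
    intro r hr
    have := hr.1
    positivity
  have hn2 : 0 ≤ ∫ r in (1:ℝ)..M, r ^ 3 * deriv U r ^ 2 := by
    apply intervalIntegral.integral_nonneg hM1
    intro r hr
    have : 0 ≤ r := by linarith [hr.1]
    positivity
  rw [← ENNReal.ofReal_add (by positivity) (by positivity), ENNReal.ofReal_le_one] at hsum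
  have hrel := rellich1 U hU2
  have hout := outer_int U hU1 M hM1 hUM (by
    have := mul_nonneg (show 0 ≤ 2 * π ^ 2 by positivity) hn1
    linarith)
  have hpt := outer_pt U hU1 M hUM 1 le_rfl hM1
  have hin := inner_int U hU1 (2 * π ^ 2 * ∫ s in (1:ℝ)..M, s ^ 3 * deriv U s ^ 2)
    (by
      have := mul_le_mul_of_nonneg_left hpt (show 0 ≤ 4 * π ^ 2 by positivity)
      linarith)
    (by
      have := mul_le_mul_of_nonneg_left hrel (show 0 ≤ 2 * π ^ 2 by positivity)
      linarith)
  have hmeas : Measurable (fun r => ENNReal.ofReal (Phi (U r))) :=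
    (Phi_cont.comp hc0).measurable.ennreal_ofReal
  calc _ = ∫⁻ x : EuclideanSpace ℝ (Fin 4), ENNReal.ofReal (Phi (U ‖x‖)) := by
        apply lintegral_congr
        intro x
        rw [huU x, Phi]
    _ = ENNReal.ofReal (2 * π ^ 2) * ∫⁻ r in Set.Ioi (0:ℝ),
          ENNReal.ofReal (r ^ 3) * ENNReal.ofReal (Phi (U r)) := polar4 _ hmeas
    _ ≤ ENNReal.ofReal (2 * π ^ 2) * (ENNReal.ofReal (Real.exp 8 * moserC) + ENNReal.ofReal outC) := by
        gcongr
        have hsplit : Set.Ioi (0:ℝ) = Set.Ioc 0 1 ∪ Set.Ioi 1 :=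
          (Set.Ioc_union_Ioi_eq_Ioi zero_le_one).symm
        rw [hsplit]
        refine (lintegral_union_le _ _ _).trans ?_
        rw [setLIntegral_congr (Ioo_ae_eq_Ioc (μ := volume) (a := (0:ℝ)) (b := 1)).symm]
        exact add_le_add hin hout
    _ = _ := by
        rw [← ENNReal.ofReal_add (by positivity) hoC.le, ← ENNReal.ofReal_mul (by positivity)]
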